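/- arXiv:0812.2321 — 6 statements merged into one kernel-verified Lean document; each statement's English description precedes it below -/
import Mathlib

section
/- Let a < b be real numbers and let z be a real number with z > b. Then ∫ₐᵇ 1/(π√((t - a)(b - t))) · 1/(z - t) dt = 1/√((z - a)(z - b)). That is, the Cauchy transform of the arcsine measure of the interval [a, b], evaluated at a real point z to the right of the interval, equals 1/√((z-a)(z-b)). -/
open Real intervalIntegral

/-- The Möbius map `t ↦ ((t-a)(z-b) - (b-t)(z-a)) / ((b-a)(z-t))` sends `[a, b]` to `[-1, 1]`; its
arcsine, divided by `π√((z-a)(z-b))`, is a primitive of the arcsine density times the Cauchy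
kernel. -/
theorem hasDerivAt_arcsin_moebius {a b z t : ℝ} (hz : b < z) (hat : a < t) (htb : t < b) :
    HasDerivAt
      (fun t ↦ arcsin (((t - a) * (z - b) - (b - t) * (z - a)) / ((b - a) * (z - t))) /
        (π * √((z - a) * (z - b))))
      ((1 / (π * √((t - a) * (b - t)))) * (1 / (z - t))) t := by
  have hab : 0 < b - a := by linarith
  have hzt : 0 < z - t := by linarith
  have hP : 0 < (z - a) * (z - b) := mul_pos (by linarith) (by linarith)
  have hQ : 0 < (t - a) * (b - t) := mul_pos (by linarith) (by linarith)
  set s : ℝ := ((t - a) * (z - b) - (b - t) * (z - a)) / ((b - a) * (z - t)) with hs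
  have hsq : 1 - s ^ 2 =
      (2 * (√((z - a) * (z - b)) * √((t - a) * (b - t))) / ((b - a) * (z - t))) ^ 2 := by
    rw [hs, div_pow, div_pow, mul_pow 2, mul_pow (√_), sq_sqrt hP.le, sq_sqrt hQ.le]
    field_simp
    ring
  have hpos : 0 < 1 - s ^ 2 := by
    rw [hsq]
    positivity
  have hderiv : HasDerivAt
      (fun t ↦ ((t - a) * (z - b) - (b - t) * (z - a)) / ((b - a) * (z - t)))
      (2 * ((z - a) * (z - b)) / ((b - a) * (z - t) ^ 2)) t := by
    have hnum := (((hasDerivAt_id' t).sub_const a).mul_const (z - b)).sub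
      (((hasDerivAt_id' t).const_sub b).mul_const (z - a))
    have hden := ((hasDerivAt_id' t).const_sub z).const_mul (b - a)
    refine (hnum.div hden (by positivity)).congr_deriv ?_
    simp only [Pi.sub_apply]
    field_simp
    ring
  have harcsin := hasDerivAt_arcsin (x := s) (by rintro h; norm_num [h] at hpos)
    (by rintro h; norm_num [h] at hpos)
  refine ((harcsin.comp t hderiv).div_const _).congr_deriv ?_
  rw [hsq, sqrt_sq (by positivity)]
  have hP' := sqrt_pos.2 hP
  have hQ' := sqrt_pos.2 hQ
  nth_rewrite 2 [← mul_self_sqrt hP.le]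
  field_simp

/-- the Cauchy transform of the arcsine measure of `[a, b]` at a
real point `z > b` equals `1/√((z-a)(z-b))`. -/
theorem stmt7 (a b z : ℝ) (hab : a < b) (hz : b < z) :
    ∫ t in a..b, (1 / (Real.pi * Real.sqrt ((t - a) * (b - t)))) * (1 / (z - t)) =
      1 / Real.sqrt ((z - a) * (z - b)) := by
  have hba : b - a ≠ 0 := by linarith
  have hza : z - a ≠ 0 := by linarith
  have hzb : z - b ≠ 0 := by linarith
  have hcont : ContinuousOn
      (fun t ↦ arcsin (((t - a) * (z - b) - (b - t) * (z - a)) / ((b - a) * (z - t))) /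
        (π * √((z - a) * (z - b)))) (Set.Icc a b) := by
    refine (continuous_arcsin.comp_continuousOn (ContinuousOn.div (by fun_prop) (by fun_prop)
      fun t ht ↦ mul_ne_zero hba ?_)).div_const _
    linarith [ht.2]
  rw [integral_eq_sub_of_hasDerivAt_of_le hab.le hcont
    fun t ht ↦ hasDerivAt_arcsin_moebius hz ht.1 ht.2]
  · have hb : ((b - a) * (z - b) - (b - b) * (z - a)) / ((b - a) * (z - b)) = 1 := by
      field_simp
      ring
    have ha : ((a - a) * (z - b) - (b - a) * (z - a)) / ((b - a) * (z - a)) = -1 := by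
      field_simp
      ring
    have hP : 0 < √((z - a) * (z - b)) :=
      sqrt_pos.2 (mul_pos (by linarith) (by linarith))
    simp only [hb, ha, arcsin_one, arcsin_neg]
    field_simp
    ring
  · rw [intervalIntegrable_iff_integrableOn_Ioc_of_le hab.le]
    refine integrableOn_deriv_of_nonneg hcont
      (fun t ht ↦ hasDerivAt_arcsin_moebius hz ht.1 ht.2) fun t ht ↦ ?_
    have : 0 < z - t := by linarith [ht.2]
    positivity
end

section
/- Let v ∈ ℝ and w < 0 be real. For θ ∈ [0,1] set ξ(θ) = -vθ² and ψ(θ) = -w(1 - θ²)θ² (so ψ(θ) ≥ 0), and let α₁(θ) = ξ(θ) - 2√ψ(θ), α₂(θ) = ξ(θ) + 2√ψ(θ). Let z ∈ ℝ satisfy z > α₂(θ) for every θ ∈ [0,1]. Then ∫₀¹ ( ∫_{α₁(θ)}^{α₂(θ)} 1/(π√((t - α₁(θ))(α₂(θ) - t))) · 1/(z - t) dt ) dθ = ∫₀¹ dθ/√((v² - 4w)θ⁴ + (2vz + 4w)θ² + z²). That is, the Cauchy transform at z of the average over θ ∈ [0,1] of the arcsine measures of the intervals [α₁(θ), α₂(θ)]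 is given by the single integral ∫₀¹ dθ/√((v² - 4w)θ⁴ + (2vz + 4w)θ² + z²). -/
open Real

/-- The Cauchy transform of the arcsine measure of `[a, b]` at a point `z` to the right of `b`. -/
theorem integral_arcsine_div_sub {a b z : ℝ} (hab : a < b) (hbz : b < z) :
    ∫ t in a..b, (1 / (Real.pi * √((t - a) * (b - t)))) * (1 / (z - t)) =
      1 / √((z - a) * (z - b)) := by
  have hb : 0 < z - b := sub_pos.2 hbz
  have ha : 0 < z - a := sub_pos.2 (hab.trans hbz)
  have hd : 0 < b - a := sub_pos.2 hab
  set R := √((z - a) * (z - b))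
  have hRpos : 0 < R := Real.sqrt_pos.2 (mul_pos ha hb)
  have hRsq : R ^ 2 = (z - a) * (z - b) := Real.sq_sqrt (mul_pos ha hb).le
  set g : ℝ → ℝ := fun t ↦ 2 * (z - b) * (t - a) / ((b - a) * (z - t)) - 1 with hg
  have hga : g a = -1 := by simp [hg]
  have hgb : g b = 1 := by
    simp only [hg]
    field_simp
    ring
  have hcont : ContinuousOn (fun t ↦ 1 / (Real.pi * R) * Real.arcsin (g t)) (Set.Icc a b) := by
    have hgc : ContinuousOn g (Set.Icc a b) := by
      refine ContinuousOn.sub (ContinuousOn.div (by fun_prop) (by fun_prop) fun t ht ↦ ?_)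
        continuousOn_const
      exact (mul_pos hd (by linarith [ht.2])).ne'
    exact continuousOn_const.mul (Real.continuous_arcsin.comp_continuousOn hgc)
  have hderiv : ∀ t ∈ Set.Ioo a b,
      HasDerivAt (fun t ↦ 1 / (Real.pi * R) * Real.arcsin (g t))
        ((1 / (Real.pi * √((t - a) * (b - t)))) * (1 / (z - t))) t := by
    rintro t ⟨hat, htb⟩
    have hta : 0 < t - a := sub_pos.2 hat
    have hbt : 0 < b - t := sub_pos.2 htb
    have hzt : 0 < z - t := by linarith
    set S := √((t - a) * (b - t))
    have hSpos : 0 < S := Real.sqrt_pos.2 (mul_pos hta hbt)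
    have hSsq : S ^ 2 = (t - a) * (b - t) := Real.sq_sqrt (mul_pos hta hbt).le
    have hg' : HasDerivAt g (2 * R ^ 2 / ((b - a) * (z - t) ^ 2)) t := by
      have h := ((((hasDerivAt_id t).sub_const a).const_mul (2 * (z - b))).div
        (((hasDerivAt_id t).const_sub z).const_mul (b - a)) (mul_pos hd hzt).ne').sub_const 1
      refine h.congr_deriv ?_
      rw [hRsq]
      simp only [id]
      field_simp
      ring
    have hone : 1 - g t ^ 2 = (2 * R * S / ((b - a) * (z - t))) ^ 2 := by
      rw [div_pow, mul_pow, mul_pow, hRsq, hSsq]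
      simp only [hg]
      field_simp
      ring
    have hpos : 0 < 2 * R * S / ((b - a) * (z - t)) := by positivity
    have hlt : 0 < 1 - g t ^ 2 := by rw [hone]; positivity
    have h := ((Real.hasDerivAt_arcsin (by rintro h; simp [h] at hlt)
      (by rintro h; simp [h] at hlt)).comp t hg').const_mul (1 / (Real.pi * R))
    refine h.congr_deriv ?_
    rw [hone, Real.sqrt_sq hpos.le]
    field_simp
  have hint := intervalIntegral.intervalIntegrable_deriv_of_nonneg
    (by rwa [Set.uIcc_of_le hab.le])
    (by rwa [min_eq_left hab.le, max_eq_right hab.le])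
    (by
      rw [min_eq_left hab.le, max_eq_right hab.le]
      intro t ht
      have : 0 < z - t := by linarith [ht.2]
      positivity)
  rw [intervalIntegral.integral_eq_sub_of_hasDerivAt_of_le hab.le hcont hderiv hint, hga, hgb,
    Real.arcsin_neg, Real.arcsin_one]
  field_simp
  ring

/-- the Cauchy transform at `z` of the average over `θ ∈ [0,1]`
of the arcsine measures of the intervals
`[ξ(θ) - 2√ψ(θ), ξ(θ) + 2√ψ(θ)]`, `ξ(θ) = -vθ²`, `ψ(θ) = -w(1-θ²)θ²`,
equals `∫₀¹ dθ/√((v²-4w)θ⁴ + (2vz+4w)θ² + z²)`. -/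
theorem stmt8 (v w : ℝ) (hw : w < 0)
    (ξ ψ α₁ α₂ : ℝ → ℝ)
    (hξ : ∀ θ : ℝ, ξ θ = -v * θ ^ 2)
    (hψ : ∀ θ : ℝ, ψ θ = -w * (1 - θ ^ 2) * θ ^ 2)
    (hα₁ : ∀ θ : ℝ, α₁ θ = ξ θ - 2 * Real.sqrt (ψ θ))
    (hα₂ : ∀ θ : ℝ, α₂ θ = ξ θ + 2 * Real.sqrt (ψ θ))
    (z : ℝ) (hz : ∀ θ ∈ Set.Icc (0 : ℝ) 1, α₂ θ < z) :
    ∫ θ in (0 : ℝ)..1,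
        (∫ t in (α₁ θ)..(α₂ θ),
          (1 / (Real.pi * Real.sqrt ((t - α₁ θ) * (α₂ θ - t)))) * (1 / (z - t))) =
      ∫ θ in (0 : ℝ)..1,
        1 / Real.sqrt ((v ^ 2 - 4 * w) * θ ^ 4 + (2 * v * z + 4 * w) * θ ^ 2 + z ^ 2) := by
  refine intervalIntegral.integral_congr_Ioo_of_le zero_le_one fun θ hθ ↦ ?_
  have hψpos : 0 < ψ θ := by
    rw [hψ]
    have : 0 < 1 - θ ^ 2 := by nlinarith [hθ.1, hθ.2]
    have := hθ.1
    have := neg_pos.2 hw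
    positivity
  have hlt : α₁ θ < α₂ θ := by
    rw [hα₁, hα₂]
    linarith [Real.sqrt_pos.2 hψpos]
  have hsq := Real.sq_sqrt hψpos.le
  refine (integral_arcsine_div_sub hlt (hz θ (Set.Ioo_subset_Icc_self hθ))).trans ?_
  congr 2
  rw [hψ] at hsq
  rw [hα₁, hα₂, hψ, hξ]
  linear_combination -4 * hsq
end

section
/- Let v, w ∈ ℝ with a := v² - 4w > 0, and let z ∈ ℝ be such that (v² - 4w)θ⁴ + (2vz + 4w)θ² + z² > 0 for every θ ∈ [0,1] and such that s := -16w(z² + vz + w)/(v² - 4w)² > 0. Set u := v(v + 2z)/(v² - 4w). Then ∫₀¹ dθ/√((v² - 4w)θ⁴ + (2vz + 4w)θ² + z²) = (1/√(2a)) ∫_{-1}^{1} dt/(√(t + 1)·√((t + u)² + s)). (This is the change of variables t = 2θ² - 1 expressing the Cauchy transform C₀(z) as I₀(s).) -/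
open Real

theorem image_two_mul_sq_sub_one_Ioc :
    (fun θ : ℝ => 2 * θ ^ 2 - 1) '' Set.Ioc 0 1 = Set.Ioc (-1) 1 := by
  ext t
  constructor
  · rintro ⟨θ, ⟨h0, h1⟩, rfl⟩
    constructor
    · dsimp only
      nlinarith [mul_pos h0 h0]
    · dsimp only
      nlinarith
  · rintro ⟨h0, h1⟩
    refine ⟨Real.sqrt ((t + 1) / 2), ⟨Real.sqrt_pos.mpr (by linarith),
      Real.sqrt_le_one.mpr (by linarith)⟩, ?_⟩
    dsimp only
    rw [Real.sq_sqrt (by linarith)]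
    ring

/-- The substitution `t = 2θ² - 1`; no integrability of `g` is needed. -/
theorem integral_neg_one_one_eq_integral_two_mul_sq_sub_one (g : ℝ → ℝ) :
    ∫ t in (-1 : ℝ)..1, g t = ∫ θ in (0 : ℝ)..1, 4 * θ * g (2 * θ ^ 2 - 1) := by
  rw [intervalIntegral.integral_of_le (by norm_num), intervalIntegral.integral_of_le (by norm_num),
    ← image_two_mul_sq_sub_one_Ioc,
    MeasureTheory.integral_image_eq_integral_abs_deriv_smul (f' := fun θ => 4 * θ)
      measurableSet_Ioc]
  · refine MeasureTheory.setIntegral_congr_fun measurableSet_Ioc fun θ hθ => ?_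
    have h : 0 ≤ 4 * θ := by linarith [hθ.1]
    simp only [abs_of_nonneg h, smul_eq_mul]
  · intro θ _
    refine (((hasDerivAt_pow 2 θ).const_mul 2).sub_const 1).hasDerivWithinAt.congr_deriv ?_
    norm_num
    ring
  · intro x hx y hy hxy
    dsimp only at hxy
    exact (pow_left_inj₀ hx.1.le hy.1.le two_ne_zero).mp (by linarith)

/-- the change of variables `t = 2θ² - 1` expressing the Cauchy
transform `C₀(z) = ∫₀¹ dθ/√((v²-4w)θ⁴ + (2vz+4w)θ² + z²)` as
`I₀(s) = (1/√(2a)) ∫₋₁¹ dt/(√(t+1)√((t+u)²+s))` with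
`a = v² - 4w`, `s = -16w(z²+vz+w)/(v²-4w)²`, `u = v(v+2z)/(v²-4w)`. -/
theorem stmt9 (v w z a s u : ℝ)
    (ha : a = v ^ 2 - 4 * w) (ha' : 0 < a)
    (hpos : ∀ θ ∈ Set.Icc (0 : ℝ) 1,
      0 < (v ^ 2 - 4 * w) * θ ^ 4 + (2 * v * z + 4 * w) * θ ^ 2 + z ^ 2)
    (hs : s = -16 * w * (z ^ 2 + v * z + w) / (v ^ 2 - 4 * w) ^ 2) (hs' : 0 < s)
    (hu : u = v * (v + 2 * z) / (v ^ 2 - 4 * w)) :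
    ∫ θ in (0 : ℝ)..1,
        1 / Real.sqrt ((v ^ 2 - 4 * w) * θ ^ 4 + (2 * v * z + 4 * w) * θ ^ 2 + z ^ 2) =
      (1 / Real.sqrt (2 * a)) *
        ∫ t in (-1 : ℝ)..1,
          1 / (Real.sqrt (t + 1) * Real.sqrt ((t + u) ^ 2 + s)) := by
  rw [integral_neg_one_one_eq_integral_two_mul_sq_sub_one, ← intervalIntegral.integral_const_mul,
    intervalIntegral.integral_of_le zero_le_one, intervalIntegral.integral_of_le zero_le_one]
  refine MeasureTheory.setIntegral_congr_fun measurableSet_Ioc fun θ hθ => ?_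
  have hθ0 : 0 < θ := hθ.1
  have hq : (v ^ 2 - 4 * w) * θ ^ 4 + (2 * v * z + 4 * w) * θ ^ 2 + z ^ 2 =
      a / 2 ^ 2 * ((2 * θ ^ 2 - 1 + u) ^ 2 + s) := by
    rw [← ha] at hs hu ⊢
    have hw : w = (v ^ 2 - a) / 4 := by linarith
    subst hs hu
    rw [hw]
    field_simp
    ring
  have ht : Real.sqrt (2 * θ ^ 2 - 1 + 1) = Real.sqrt 2 * θ := by
    rw [sub_add_cancel, Real.sqrt_mul zero_le_two, Real.sqrt_sq hθ0.le]
  have hQ : 0 < Real.sqrt ((2 * θ ^ 2 - 1 + u) ^ 2 + s) := Real.sqrt_pos.mpr (by positivity)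
  have ha0 : 0 < Real.sqrt a := Real.sqrt_pos.mpr ha'
  have h2 : 0 < Real.sqrt 2 := Real.sqrt_pos.mpr two_pos
  rw [hq, ht, Real.sqrt_mul (by positivity), Real.sqrt_div ha'.le, Real.sqrt_sq zero_le_two,
    Real.sqrt_mul zero_le_two]
  field_simp
  rw [Real.sq_sqrt zero_le_two]
  norm_num
end

section
/- For each natural number ν and each real s > 0, the function I_ν is differentiable at s with derivative I_ν'(s) = -(1/(2√2)) ∫_{-1}^{1} t^ν/(√(t + 1)·(t² + s)^{3/2}) dt, and moreover the recurrence ∂I_{ν+2}/∂s (s) = -(1/2)·I_ν(s) - s·∂I_ν/∂s (s) holds. -/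
open Real

/-- `I_ν(s) = (1/√2) ∫₋₁¹ tᵛ/(√(t+1)√(t²+s)) dt`. -/
noncomputable def Inu (ν : ℕ) (s : ℝ) : ℝ :=
  (1 / Real.sqrt 2) * ∫ t in (-1 : ℝ)..1, t ^ ν / (Real.sqrt (t + 1) * Real.sqrt (t ^ 2 + s))

theorem rpow_three_halves {x : ℝ} (hx : 0 < x) : x ^ ((3 : ℝ) / 2) = x * √x := by
  rw [show (3 : ℝ) / 2 = 1 + 1 / 2 by norm_num, rpow_add hx, rpow_one, sqrt_eq_rpow]

theorem intervalIntegrable_inv_sqrt_add_one :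
    IntervalIntegrable (fun t : ℝ => (√(t + 1))⁻¹) MeasureTheory.volume (-1) 1 := by
  have h : IntervalIntegrable (fun t : ℝ => t ^ (-(1 / 2) : ℝ)) MeasureTheory.volume 0 2 :=
    intervalIntegral.intervalIntegrable_rpow' (by norm_num)
  have h' := h.comp_add_right 1
  norm_num at h'
  refine h'.congr fun t ht => ?_
  rw [Set.uIoc_of_le (by norm_num)] at ht
  have ht' : 0 ≤ t + 1 := by linarith [ht.1]
  simp only [sqrt_eq_rpow, ← rpow_neg ht']

theorem intervalIntegrable_div_sqrt_add_one_mul {f g : ℝ → ℝ} (hf : Continuous f)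
    (hg : Continuous g) (h0 : ∀ t, g t ≠ 0) :
    IntervalIntegrable (fun t => f t / (√(t + 1) * g t)) MeasureTheory.volume (-1) 1 := by
  refine (intervalIntegrable_inv_sqrt_add_one.mul_continuousOn
    (hf.div hg h0).continuousOn).congr fun t _ => ?_
  simp only [Pi.div_apply, div_eq_mul_inv, mul_inv]
  ring

theorem intervalIntegrable_Inu_integrand (ν : ℕ) {s : ℝ} (hs : 0 < s) :
    IntervalIntegrable (fun t : ℝ => t ^ ν / (√(t + 1) * √(t ^ 2 + s)))
      MeasureTheory.volume (-1) 1 :=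
  intervalIntegrable_div_sqrt_add_one_mul (by fun_prop) (by fun_prop) fun t => by positivity

theorem intervalIntegrable_Inu_deriv_integrand (ν : ℕ) {s : ℝ} (hs : 0 < s) :
    IntervalIntegrable (fun t : ℝ => t ^ ν / (√(t + 1) * (t ^ 2 + s) ^ ((3 : ℝ) / 2)))
      MeasureTheory.volume (-1) 1 :=
  intervalIntegrable_div_sqrt_add_one_mul (by fun_prop)
    (Continuous.rpow_const (by fun_prop) fun _ => Or.inr (by norm_num)) fun t => by positivity

theorem hasDerivAt_Inu_integrand (ν : ℕ) {s t : ℝ} (hs : 0 < s) :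
    HasDerivAt (fun x : ℝ => t ^ ν / (√(t + 1) * √(t ^ 2 + x)))
      (-(1 / 2) * (t ^ ν / (√(t + 1) * (t ^ 2 + s) ^ ((3 : ℝ) / 2)))) s := by
  have hpos : 0 < t ^ 2 + s := by positivity
  have h := ((((hasDerivAt_id s).const_add (t ^ 2)).sqrt hpos.ne').inv
    (sqrt_pos.2 hpos).ne').const_mul (t ^ ν * (√(t + 1))⁻¹)
  refine (h.congr_deriv ?_).congr_of_eventuallyEq (Filter.Eventually.of_forall fun x => ?_)
  · rw [rpow_three_halves hpos]
    simp only [id, sq_sqrt hpos.le]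
    simp only [div_eq_mul_inv, mul_inv]
    ring
  · simp only [div_eq_mul_inv, mul_inv, mul_assoc, Pi.inv_apply, id]

theorem hasDerivAt_Inu (ν : ℕ) {s : ℝ} (hs : 0 < s) :
    HasDerivAt (Inu ν)
      (-(1 / (2 * √2)) *
        ∫ t in (-1 : ℝ)..1, t ^ ν / (√(t + 1) * (t ^ 2 + s) ^ ((3 : ℝ) / 2))) s := by
  have key := (intervalIntegral.hasDerivAt_integral_of_dominated_loc_of_deriv_le
    (μ := MeasureTheory.volume) (a := -1) (b := 1) (x₀ := s) (s := Set.Ioi (s / 2))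
    (F := fun x t => t ^ ν / (√(t + 1) * √(t ^ 2 + x)))
    (F' := fun x t => -(1 / 2) * (t ^ ν / (√(t + 1) * (t ^ 2 + x) ^ ((3 : ℝ) / 2))))
    (bound := fun t => (√(t + 1))⁻¹ * ((s / 2) ^ ((3 : ℝ) / 2))⁻¹)
    (Ioi_mem_nhds (by linarith)) ?_ (intervalIntegrable_Inu_integrand ν hs) ?_ ?_
    (intervalIntegrable_inv_sqrt_add_one.mul_const _) ?_).2
  · refine (key.const_mul (1 / √2)).congr_deriv ?_
    rw [intervalIntegral.integral_const_mul]
    simp only [div_eq_mul_inv, mul_inv]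
    ring
  · exact Filter.Eventually.of_forall fun x => Measurable.aestronglyMeasurable (by fun_prop)
  · exact Measurable.aestronglyMeasurable (by fun_prop)
  · refine Filter.Eventually.of_forall fun t ht x hx => ?_
    rw [Set.uIoc_of_le (by norm_num)] at ht
    have hx : s / 2 < x := hx
    have hle : (s / 2) ^ ((3 : ℝ) / 2) ≤ (t ^ 2 + x) ^ ((3 : ℝ) / 2) :=
      rpow_le_rpow (by positivity) (by nlinarith [sq_nonneg t]) (by norm_num)
    have hpow : |t| ^ ν ≤ 1 := pow_le_one₀ (abs_nonneg t) (abs_le.2 ⟨ht.1.le, ht.2⟩)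
    have hx0 : 0 < x := by linarith
    have h1 : 0 ≤ (t ^ 2 + x) ^ ((3 : ℝ) / 2) := by positivity
    have hinv : ((t ^ 2 + x) ^ ((3 : ℝ) / 2))⁻¹ ≤ ((s / 2) ^ ((3 : ℝ) / 2))⁻¹ :=
      inv_anti₀ (by positivity) hle
    calc ‖-(1 / 2) * (t ^ ν / (√(t + 1) * (t ^ 2 + x) ^ ((3 : ℝ) / 2)))‖
        = 1 / 2 * |t| ^ ν * ((√(t + 1))⁻¹ * ((t ^ 2 + x) ^ ((3 : ℝ) / 2))⁻¹) := by
          rw [norm_eq_abs, abs_mul, abs_div, abs_mul, abs_pow, abs_of_nonneg h1,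
            abs_of_nonneg (sqrt_nonneg _), abs_neg, abs_of_pos (by norm_num : (0 : ℝ) < 1 / 2)]
          simp only [div_eq_mul_inv, mul_inv]
          ring
      _ ≤ 1 * ((√(t + 1))⁻¹ * ((s / 2) ^ ((3 : ℝ) / 2))⁻¹) := by
          gcongr
          linarith
      _ = _ := one_mul _
  · exact Filter.Eventually.of_forall fun t _ x hx =>
      hasDerivAt_Inu_integrand ν ((half_pos hs).trans hx)

theorem integral_Inu_deriv_integrand_add_two (ν : ℕ) {s : ℝ} (hs : 0 < s) :
    ∫ t in (-1 : ℝ)..1, t ^ (ν + 2) / (√(t + 1) * (t ^ 2 + s) ^ ((3 : ℝ) / 2)) =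
      (∫ t in (-1 : ℝ)..1, t ^ ν / (√(t + 1) * √(t ^ 2 + s))) -
        s * ∫ t in (-1 : ℝ)..1, t ^ ν / (√(t + 1) * (t ^ 2 + s) ^ ((3 : ℝ) / 2)) := by
  rw [← intervalIntegral.integral_const_mul, ← intervalIntegral.integral_sub
    (intervalIntegrable_Inu_integrand ν hs)
    ((intervalIntegrable_Inu_deriv_integrand ν hs).const_mul s)]
  congr 1
  ext t
  have hpos : 0 < t ^ 2 + s := by positivity
  have hsqrt := sqrt_pos.2 hpos
  rw [rpow_three_halves hpos]
  simp only [div_eq_mul_inv, mul_inv]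
  field_simp
  ring

/-- `I_ν` is differentiable at every `s > 0` with derivative
`-(1/(2√2)) ∫₋₁¹ tᵛ/(√(t+1)(t²+s)^{3/2}) dt`, and the recurrence
`∂I_{ν+2}/∂s = -(1/2)I_ν - s ∂I_ν/∂s` holds. -/
theorem stmt10 (ν : ℕ) (s : ℝ) (hs : 0 < s) :
    HasDerivAt (Inu ν)
      (-(1 / (2 * Real.sqrt 2)) *
        ∫ t in (-1 : ℝ)..1, t ^ ν / (Real.sqrt (t + 1) * (t ^ 2 + s) ^ ((3 : ℝ) / 2))) s ∧
    deriv (Inu (ν + 2)) s = -(1 / 2) * Inu ν s - s * deriv (Inu ν) s := by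
  refine ⟨hasDerivAt_Inu ν hs, ?_⟩
  rw [(hasDerivAt_Inu (ν + 2) hs).deriv, (hasDerivAt_Inu ν hs).deriv,
    integral_Inu_deriv_integrand_add_two ν hs, Inu]
  simp only [div_eq_mul_inv, mul_inv]
  ring
end

section
/- For every real s > 0, the function I₀ is differentiable at s and I₁(s) = 4s(1 + s)·I₀'(s) + s·I₀(s) + 2√(s + 1). -/
open Real

theorem intervalIntegrable_inv_sqrt_mul {g : ℝ → ℝ} (hg : Continuous g) :
    IntervalIntegrable (fun t : ℝ => (√(t + 1))⁻¹ * g t) MeasureTheory.volume (-1) 1 :=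
  intervalIntegrable_inv_sqrt_add_one.mul_continuousOn hg.continuousOn

theorem continuous_inv_sqrt_sq_add {s : ℝ} (hs : 0 < s) :
    Continuous fun t : ℝ => (√(t ^ 2 + s))⁻¹ :=
  Continuous.inv₀ (by fun_prop) fun t => (Real.sqrt_pos.2 (by positivity)).ne'

theorem hasDerivAt_inv_sqrt_const_add {c x : ℝ} (h : 0 < c + x) :
    HasDerivAt (fun y : ℝ => (√(c + y))⁻¹) (-(1 / 2) * (√(c + x))⁻¹ ^ 3) x := by
  have h0 : √(c + x) ≠ 0 := (Real.sqrt_pos.2 h).ne'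
  refine (((hasDerivAt_id x).const_add c).sqrt h.ne').fun_inv h0 |>.congr_deriv ?_
  simp only [id]
  field_simp

theorem hasDerivAt_Inu_zero {s : ℝ} (hs : 0 < s) :
    HasDerivAt (Inu 0) ((1 / √2) * ∫ t in (-1 : ℝ)..1,
      (√(t + 1))⁻¹ * (-(1 / 2) * (√(t ^ 2 + s))⁻¹ ^ 3)) s := by
  have hI : Inu 0 = fun x => (1 / √2) * ∫ t in (-1 : ℝ)..1,
      (√(t + 1))⁻¹ * (√(t ^ 2 + x))⁻¹ := by
    funext x
    simp [Inu, mul_comm]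
  rw [hI]
  refine HasDerivAt.const_mul _ ?_
  refine (intervalIntegral.hasDerivAt_integral_of_dominated_loc_of_deriv_le
    (F := fun x t => (√(t + 1))⁻¹ * (√(t ^ 2 + x))⁻¹)
    (F' := fun x t => (√(t + 1))⁻¹ * (-(1 / 2) * (√(t ^ 2 + x))⁻¹ ^ 3))
    (bound := fun t => (√(t + 1))⁻¹ * ((1 / 2) * (√(s / 2))⁻¹ ^ 3))
    (Ioi_mem_nhds (half_lt_self hs)) ?_ ?_ ?_ ?_ ?_ ?_).2
  · exact Filter.Eventually.of_forall fun x => by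
      apply Measurable.aestronglyMeasurable
      fun_prop
  · exact intervalIntegrable_inv_sqrt_mul (continuous_inv_sqrt_sq_add hs)
  · apply Measurable.aestronglyMeasurable
    fun_prop
  · refine Filter.Eventually.of_forall fun t _ x hx => ?_
    have hx : s / 2 < x := hx
    have h2 : 0 < √(s / 2) := Real.sqrt_pos.2 (by positivity)
    have h3 : √(s / 2) ≤ √(t ^ 2 + x) := Real.sqrt_le_sqrt (by nlinarith [sq_nonneg t])
    rw [norm_mul, norm_mul, norm_neg, norm_pow, norm_inv, norm_inv,
      Real.norm_of_nonneg (Real.sqrt_nonneg _), Real.norm_of_nonneg (Real.sqrt_nonneg _),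
      Real.norm_of_nonneg (by norm_num : (0 : ℝ) ≤ 1 / 2)]
    gcongr
  · exact intervalIntegrable_inv_sqrt_mul continuous_const
  · refine Filter.Eventually.of_forall fun t _ x hx => ?_
    have hx : s / 2 < x := hx
    exact (hasDerivAt_inv_sqrt_const_add (by nlinarith [sq_nonneg t])).const_mul _

theorem integral_eq_two_sqrt_two_mul {s : ℝ} (hs : 0 < s) :
    ∫ t in (-1 : ℝ)..1, (√(t + 1))⁻¹ * ((t - s) * (√(t ^ 2 + s))⁻¹ +
      2 * s * (1 + s) * (√(t ^ 2 + s))⁻¹ ^ 3) = √2 * (2 * √(s + 1)) := by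
  have hc := continuous_inv_sqrt_sq_add hs
  rw [intervalIntegral.integral_eq_sub_of_hasDerivAt_of_le (by norm_num)
    (f := fun t => √(t + 1) * ((2 * t + 2 * s) * (√(t ^ 2 + s))⁻¹))]
  · have h1 : √(s + 1) ≠ 0 := (Real.sqrt_pos.2 (by positivity)).ne'
    have h2 : √(s + 1) ^ 2 = s + 1 := Real.sq_sqrt (by positivity)
    norm_num
    rw [add_comm 1 s]
    field_simp
    rw [h2]
    ring
  · fun_prop
  · intro t ht
    have ht1 : 0 < t + 1 := by linarith [ht.1]
    have hR : 0 < t ^ 2 + s := by positivity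
    have h1 : √(t + 1) ≠ 0 := (Real.sqrt_pos.2 ht1).ne'
    have h2 : √(t ^ 2 + s) ≠ 0 := (Real.sqrt_pos.2 hR).ne'
    have h3 : √(t + 1) ^ 2 = t + 1 := Real.sq_sqrt ht1.le
    have h4 : √(t ^ 2 + s) ^ 2 = t ^ 2 + s := Real.sq_sqrt hR.le
    have hd := (((hasDerivAt_id t).add_const 1).sqrt ht1.ne').mul
      ((((hasDerivAt_id t).const_mul 2).add_const (2 * s)).mul
        ((((hasDerivAt_pow 2 t).add_const s).sqrt hR.ne').fun_inv h2))
    refine hd.congr_deriv ?_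
    simp only [id, Pi.mul_apply]
    field_simp
    rw [h3, h4]
    ring
  · exact intervalIntegrable_inv_sqrt_mul (by fun_prop)

/-- for `s > 0`, `I₀` is differentiable at `s` and
`I₁(s) = 4s(1+s) I₀'(s) + s I₀(s) + 2√(s+1)`. -/
theorem stmt14 (s : ℝ) (hs : 0 < s) :
    DifferentiableAt ℝ (Inu 0) s ∧
    Inu 1 s = 4 * s * (1 + s) * deriv (Inu 0) s + s * Inu 0 s + 2 * Real.sqrt (s + 1) := by
  have hd := hasDerivAt_Inu_zero hs
  refine ⟨hd.differentiableAt, ?_⟩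
  rw [hd.deriv]
  have hc := continuous_inv_sqrt_sq_add hs
  have h0 : Inu 0 s = (1 / √2) * ∫ t in (-1 : ℝ)..1, (√(t + 1))⁻¹ * (√(t ^ 2 + s))⁻¹ := by
    simp [Inu, mul_comm]
  have h1 : Inu 1 s =
      (1 / √2) * ∫ t in (-1 : ℝ)..1, (√(t + 1))⁻¹ * (t * (√(t ^ 2 + s))⁻¹) := by
    simp only [Inu, pow_one, div_eq_mul_inv, mul_inv, mul_left_comm]
  have key : (∫ t in (-1 : ℝ)..1, (√(t + 1))⁻¹ * (t * (√(t ^ 2 + s))⁻¹)) =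
      4 * s * (1 + s) * (∫ t in (-1 : ℝ)..1,
        (√(t + 1))⁻¹ * (-(1 / 2) * (√(t ^ 2 + s))⁻¹ ^ 3)) +
      s * (∫ t in (-1 : ℝ)..1, (√(t + 1))⁻¹ * (√(t ^ 2 + s))⁻¹) + √2 * (2 * √(s + 1)) := by
    rw [← integral_eq_two_sqrt_two_mul hs, ← intervalIntegral.integral_const_mul,
      ← intervalIntegral.integral_const_mul, ← intervalIntegral.integral_add,
      ← intervalIntegral.integral_add]
    · congr 1
      funext t
      ring
    · exact ((intervalIntegrable_inv_sqrt_mul (by fun_prop)).const_mul _).add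
        ((intervalIntegrable_inv_sqrt_mul hc).const_mul _)
    · exact intervalIntegrable_inv_sqrt_mul (by fun_prop)
    · exact (intervalIntegrable_inv_sqrt_mul (by fun_prop)).const_mul _
    · exact (intervalIntegrable_inv_sqrt_mul hc).const_mul _
  rw [h0, h1, key]
  have h2 : 1 / √(2 : ℝ) * √2 = 1 := one_div_mul_cancel (by positivity)
  linear_combination 2 * √(s + 1) * h2
end

section
/- Define C₀(z) = ∫₀¹ dθ/√(θ⁴ - θ² + z²) for real z > 1/2 (the integrand is well defined since θ⁴ - θ² + z² ≥ z² - 1/4 > 0 for θ ∈ [0,1]). Then C₀ is twice differentiable on (1/2, ∞) and satisfies, for every z > 1/2, the differential equation z(4z² - 1)·C₀''(z) + (12z² - 1)·C₀'(z) + 3z·C₀(z) + 1 = 0; equivalently, with Q(z) = z(4z² - 1), it satisfies Q(z)C₀''(z) + Q'(z)C₀'(z) + (Q''(z)/8)C₀(z) + Q'''(z)/24 = 0. -/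
open Real

/-- `C₀(z) = ∫₀¹ dθ/√(θ⁴ - θ² + z²)`, the Cauchy transform associated with the
root at the origin of `Q(z) = z(4z² - 1)`. -/
noncomputable def C₀ (z : ℝ) : ℝ :=
  ∫ θ in (0 : ℝ)..1, 1 / Real.sqrt (θ ^ 4 - θ ^ 2 + z ^ 2)

open MeasureTheory Set Topology in
/-- Differentiation under the integral sign over a compact interval, for a jointly continuous
integrand whose derivative in the parameter is jointly continuous. -/
theorem hasDerivAt_intervalIntegral_of_continuousOn {F F' : ℝ → ℝ → ℝ} {a b z : ℝ} {U : Set ℝ}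
    (hU : IsOpen U) (hz : z ∈ U)
    (hF : ContinuousOn (Function.uncurry F) (U ×ˢ uIcc a b))
    (hF' : ContinuousOn (Function.uncurry F') (U ×ˢ uIcc a b))
    (hd : ∀ x ∈ U, ∀ t ∈ uIcc a b, HasDerivAt (fun y => F y t) (F' x t) x) :
    HasDerivAt (fun x => ∫ t in a..b, F x t) (∫ t in a..b, F' z t) z := by
  have slice {G : ℝ → ℝ → ℝ} (hG : ContinuousOn (Function.uncurry G) (U ×ˢ uIcc a b)) {x : ℝ}
      (hx : x ∈ U) : ContinuousOn (G x) (uIcc a b) :=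
    hG.comp (f := fun t => (x, t)) (by fun_prop) fun t ht => ⟨hx, ht⟩
  have meas {G : ℝ → ℝ → ℝ} (hG : ContinuousOn (Function.uncurry G) (U ×ˢ uIcc a b)) {x : ℝ}
      (hx : x ∈ U) : AEStronglyMeasurable (G x) (volume.restrict (uIoc a b)) :=
    ((slice hG hx).mono uIoc_subset_uIcc).aestronglyMeasurable measurableSet_uIoc
  obtain ⟨r, hr, hrU⟩ := Metric.nhds_basis_closedBall.mem_iff.1 (hU.mem_nhds hz)
  obtain ⟨C, hC⟩ := ((isCompact_closedBall z r).prod isCompact_uIcc).exists_bound_of_continuousOn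
    (hF'.mono (prod_mono_left hrU))
  refine (intervalIntegral.hasDerivAt_integral_of_dominated_loc_of_deriv_le (F := F) (F' := F')
    (bound := fun _ => C) (Metric.closedBall_mem_nhds z hr) ?_ (slice hF hz).intervalIntegrable
    (meas hF' hz) ?_ intervalIntegrable_const ?_).2
  · filter_upwards [hU.mem_nhds hz] with x hx using meas hF hx
  · exact .of_forall fun t ht x hx => hC (x, t) ⟨hx, uIoc_subset_uIcc ht⟩
  · exact .of_forall fun t ht x hx => hd x (hrU hx) t (uIoc_subset_uIcc ht)

theorem quartic_pos {z : ℝ} (hz : 1 / 2 < z) (θ : ℝ) : 0 < θ ^ 4 - θ ^ 2 + z ^ 2 := by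
  nlinarith [sq_nonneg (θ ^ 2 - 1 / 2)]

theorem hasDerivAt_sqrt_quartic_left {z : ℝ} (hz : 1 / 2 < z) (θ : ℝ) :
    HasDerivAt (fun x => √(θ ^ 4 - θ ^ 2 + x ^ 2)) (z / √(θ ^ 4 - θ ^ 2 + z ^ 2)) z := by
  convert ((hasDerivAt_pow 2 z).const_add (θ ^ 4 - θ ^ 2)).sqrt (quartic_pos hz θ).ne' using 1
  have := (Real.sqrt_pos.2 (quartic_pos hz θ)).ne'
  field_simp
  norm_num
  ring

theorem hasDerivAt_sqrt_quartic_right {z : ℝ} (hz : 1 / 2 < z) (θ : ℝ) :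
    HasDerivAt (fun t => √(t ^ 4 - t ^ 2 + z ^ 2))
      ((2 * θ ^ 3 - θ) / √(θ ^ 4 - θ ^ 2 + z ^ 2)) θ := by
  refine ((((hasDerivAt_pow 4 θ).sub (hasDerivAt_pow 2 θ)).add_const (z ^ 2)).sqrt
    (quartic_pos hz θ).ne').congr_deriv ?_
  have := (Real.sqrt_pos.2 (quartic_pos hz θ)).ne'
  simp only [Pi.sub_apply]
  field_simp
  norm_num
  ring

theorem sqrt_quartic_ne_zero {p : ℝ × ℝ} (hp : p ∈ Set.Ioi (1 / 2 : ℝ) ×ˢ Set.uIcc (0 : ℝ) 1) :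
    √(p.2 ^ 4 - p.2 ^ 2 + p.1 ^ 2) ≠ 0 :=
  (Real.sqrt_pos.2 (quartic_pos hp.1 p.2)).ne'

theorem hasDerivAt_C₀ {z : ℝ} (hz : 1 / 2 < z) :
    HasDerivAt C₀ (∫ θ in (0 : ℝ)..1, -z / √(θ ^ 4 - θ ^ 2 + z ^ 2) ^ 3) z := by
  unfold C₀
  refine hasDerivAt_intervalIntegral_of_continuousOn
    (F := fun z θ => 1 / √(θ ^ 4 - θ ^ 2 + z ^ 2))
    (F' := fun z θ => -z / √(θ ^ 4 - θ ^ 2 + z ^ 2) ^ 3) isOpen_Ioi hz ?_ ?_ ?_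
  · exact ContinuousOn.div (by fun_prop) (by fun_prop) fun p hp => sqrt_quartic_ne_zero hp
  · exact ContinuousOn.div (by fun_prop) (by fun_prop)
      fun p hp => pow_ne_zero _ (sqrt_quartic_ne_zero hp)
  · intro x hx θ _
    have h0 := (Real.sqrt_pos.2 (quartic_pos hx θ)).ne'
    refine ((hasDerivAt_const x (1 : ℝ)).div (hasDerivAt_sqrt_quartic_left hx θ) h0).congr_deriv ?_
    field_simp
    ring

theorem hasDerivAt_deriv_C₀ {z : ℝ} (hz : 1 / 2 < z) :
    HasDerivAt (deriv C₀) (∫ θ in (0 : ℝ)..1,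
      (3 * z ^ 2 - √(θ ^ 4 - θ ^ 2 + z ^ 2) ^ 2) / √(θ ^ 4 - θ ^ 2 + z ^ 2) ^ 5) z := by
  have key : HasDerivAt (fun x => ∫ θ in (0 : ℝ)..1, -x / √(θ ^ 4 - θ ^ 2 + x ^ 2) ^ 3)
      (∫ θ in (0 : ℝ)..1,
        (3 * z ^ 2 - √(θ ^ 4 - θ ^ 2 + z ^ 2) ^ 2) / √(θ ^ 4 - θ ^ 2 + z ^ 2) ^ 5) z := by
    refine hasDerivAt_intervalIntegral_of_continuousOn
      (F := fun z θ => -z / √(θ ^ 4 - θ ^ 2 + z ^ 2) ^ 3)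
      (F' := fun z θ => (3 * z ^ 2 - √(θ ^ 4 - θ ^ 2 + z ^ 2) ^ 2) /
        √(θ ^ 4 - θ ^ 2 + z ^ 2) ^ 5) isOpen_Ioi hz ?_ ?_ ?_
    · exact ContinuousOn.div (by fun_prop) (by fun_prop)
        fun p hp => pow_ne_zero _ (sqrt_quartic_ne_zero hp)
    · exact ContinuousOn.div (by fun_prop) (by fun_prop)
        fun p hp => pow_ne_zero _ (sqrt_quartic_ne_zero hp)
    · intro x hx θ _
      have h0 := (Real.sqrt_pos.2 (quartic_pos hx θ)).ne'
      refine ((hasDerivAt_neg x).div ((hasDerivAt_sqrt_quartic_left hx θ).pow 3)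
        (pow_ne_zero 3 h0)).congr_deriv ?_
      simp only [Pi.pow_apply, Nat.cast_ofNat, Nat.add_one_sub_one]
      field_simp
      ring
  refine key.congr_of_eventuallyEq ?_
  filter_upwards [Ioi_mem_nhds hz] with x hx using (hasDerivAt_C₀ hx).deriv

/-- The differential operator applied to the integrand of `C₀` is an exact derivative in `θ`. -/
theorem hasDerivAt_primitive {z : ℝ} (hz : 1 / 2 < z) (θ : ℝ) :
    HasDerivAt
      (fun t => z * (-(z ^ 2 + 1) * t + 4 * t ^ 3 - 3 * t ^ 5) / √(t ^ 4 - t ^ 2 + z ^ 2) ^ 3)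
      (z * (4 * z ^ 2 - 1) * ((3 * z ^ 2 - √(θ ^ 4 - θ ^ 2 + z ^ 2) ^ 2) /
          √(θ ^ 4 - θ ^ 2 + z ^ 2) ^ 5) +
        (12 * z ^ 2 - 1) * (-z / √(θ ^ 4 - θ ^ 2 + z ^ 2) ^ 3) +
        3 * z * (1 / √(θ ^ 4 - θ ^ 2 + z ^ 2))) θ := by
  have h0 := (Real.sqrt_pos.2 (quartic_pos hz θ)).ne'
  have hsq := Real.sq_sqrt (quartic_pos hz θ).le
  have hN : HasDerivAt (fun t : ℝ => z * (-(z ^ 2 + 1) * t + 4 * t ^ 3 - 3 * t ^ 5))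
      (z * (-(z ^ 2 + 1) + 12 * θ ^ 2 - 15 * θ ^ 4)) θ := by
    refine (((((hasDerivAt_id θ).const_mul (-(z ^ 2 + 1))).add
      ((hasDerivAt_pow 3 θ).const_mul 4)).sub
      ((hasDerivAt_pow 5 θ).const_mul 3)).const_mul z).congr_deriv ?_
    push_cast
    ring
  refine (hN.div ((hasDerivAt_sqrt_quartic_right hz θ).pow 3)
    (pow_ne_zero 3 h0)).congr_deriv ?_
  simp only [Pi.pow_apply]
  generalize √(θ ^ 4 - θ ^ 2 + z ^ 2) = s at h0 hsq
  have h4 : s ^ 4 = (θ ^ 4 - θ ^ 2 + z ^ 2) ^ 2 := by rw [← hsq]; ring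
  have h6 : s ^ 6 = (θ ^ 4 - θ ^ 2 + z ^ 2) ^ 3 := by rw [← hsq]; ring
  field_simp
  norm_num
  ring_nf
  simp only [hsq, h4, h6]
  ring

/-- `C₀` is twice differentiable on `(1/2, ∞)` and satisfies
`z(4z²-1) C₀'' + (12z²-1) C₀' + 3z C₀ + 1 = 0`, i.e. with `Q(z) = z(4z²-1)`,
`Q C₀'' + Q' C₀' + (Q''/8) C₀ + Q'''/24 = 0`. -/
theorem stmt16 :
    (∀ z ∈ Set.Ioi ((1 : ℝ) / 2),
        DifferentiableAt ℝ C₀ z ∧ DifferentiableAt ℝ (deriv C₀) z) ∧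
    ∀ z ∈ Set.Ioi ((1 : ℝ) / 2),
      z * (4 * z ^ 2 - 1) * deriv (deriv C₀) z +
          (12 * z ^ 2 - 1) * deriv C₀ z + 3 * z * C₀ z + 1 = 0 := by
  refine ⟨fun z hz => ⟨(hasDerivAt_C₀ hz).differentiableAt,
    (hasDerivAt_deriv_C₀ hz).differentiableAt⟩, fun z hz => ?_⟩
  have hs (θ : ℝ) : √(θ ^ 4 - θ ^ 2 + z ^ 2) ≠ 0 := (Real.sqrt_pos.2 (quartic_pos hz θ)).ne'
  have hs3 (θ : ℝ) := pow_ne_zero 3 (hs θ)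
  have hs5 (θ : ℝ) := pow_ne_zero 5 (hs θ)
  have c0 : Continuous fun θ : ℝ => 1 / √(θ ^ 4 - θ ^ 2 + z ^ 2) :=
    Continuous.div (by fun_prop) (by fun_prop) hs
  have c1 : Continuous fun θ : ℝ => -z / √(θ ^ 4 - θ ^ 2 + z ^ 2) ^ 3 :=
    Continuous.div (by fun_prop) (by fun_prop) hs3
  have c2 : Continuous fun θ : ℝ =>
      (3 * z ^ 2 - √(θ ^ 4 - θ ^ 2 + z ^ 2) ^ 2) / √(θ ^ 4 - θ ^ 2 + z ^ 2) ^ 5 :=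
    Continuous.div (by fun_prop) (by fun_prop) hs5
  have i0 := (c0.const_mul (3 * z)).intervalIntegrable (μ := MeasureTheory.volume) 0 1
  have i1 := (c1.const_mul (12 * z ^ 2 - 1)).intervalIntegrable (μ := MeasureTheory.volume) 0 1
  have i2 := (c2.const_mul (z * (4 * z ^ 2 - 1))).intervalIntegrable
    (μ := MeasureTheory.volume) 0 1
  have ftc := intervalIntegral.integral_eq_sub_of_hasDerivAt
    (fun θ _ => hasDerivAt_primitive hz θ) ((i2.add i1).add i0)
  rw [intervalIntegral.integral_add (i2.add i1) i0, intervalIntegral.integral_add i2 i1,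
    intervalIntegral.integral_const_mul, intervalIntegral.integral_const_mul,
    intervalIntegral.integral_const_mul] at ftc
  rw [(hasDerivAt_deriv_C₀ hz).deriv, (hasDerivAt_C₀ hz).deriv]
  unfold C₀
  rw [ftc]
  have hz0 : 0 < z := lt_trans (by norm_num) hz
  norm_num [Real.sqrt_sq hz0.le]
  field_simp
  ring
end
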